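/- Let φ ∈ Φ, let {K_w}_{w>0} satisfy condition (K_w.1) with absolute constant A > 0, and let f ∈ BV^φ(ℝ^N_+) be in the domain of the operators T_w. Then for every λ > 0, every δ ∈ (0,1) and every w > 0, V^φ[λ(T_w f − f)] ≤ ω^φ(λ A f, δ) + A^{−1} V^φ[2 λ A f] ∫_{|1−t|>δ} |K_w(t)| ⟨t⟩^{−1} dt. -/

import Mathlib

open MeasureTheory Filter Set Asymptotics
open scoped ENNReal

noncomputable section

/-- The class `Φ`: `φ : [0,∞) → [0,∞)` convex, vanishing exactly at `0`,
with `φ(u)/u → 0` as `u → 0⁺`. -/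
def IsPhiFun (φ : ℝ → ℝ) : Prop :=
  ConvexOn ℝ (Set.Ici 0) φ ∧ (∀ u, 0 ≤ u → 0 ≤ φ u) ∧
  (∀ u, 0 ≤ u → (φ u = 0 ↔ u = 0)) ∧
  Tendsto (fun u => φ u / u) (nhdsWithin 0 (Set.Ioi 0)) (nhds 0)

/-- The positive orthant `ℝ^N_+ = (0,∞)^N`. -/
def RPos (N : ℕ) : Set (Fin N → ℝ) := {x | ∀ i, 0 < x i}

/-- `⟨t⟩ := ∏ᵢ tᵢ`. -/
def prodCoord {N : ℕ} (t : Fin N → ℝ) : ℝ := ∏ i, t i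

/-- Euclidean distance `|1 - t|`. -/
def distOne {N : ℕ} (t : Fin N → ℝ) : ℝ := Real.sqrt (∑ i, (1 - t i) ^ 2)

/-- Euclidean norm `|log t|` of `log t := (log t₁, …, log t_N)`. -/
def logNorm {N : ℕ} (t : Fin N → ℝ) : ℝ := Real.sqrt (∑ i, Real.log (t i) ^ 2)

/-- `t^w := (t₁^w, …, t_N^w)`. -/
def powVec {N : ℕ} (t : Fin N → ℝ) (w : ℝ) : Fin N → ℝ := fun i => t i ^ w

/-- The (Musielak–Orlicz) `φ`-variation of `g` on `[a,b]`:
`sup_D ∑ᵢ φ(|g(sᵢ) - g(sᵢ₋₁)|)` over all partitions `D` of `[a,b]`. -/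
def phiVar1 (φ : ℝ → ℝ) (a b : ℝ) (g : ℝ → ℝ) : ℝ≥0∞ :=
  ⨆ (n : ℕ) (u : Fin (n + 1) → ℝ) (_ : Monotone u) (_ : u 0 = a) (_ : u (Fin.last n) = b),
    ∑ i : Fin n, ENNReal.ofReal (φ |g (u i.succ) - g (u i.castSucc)|)

/-- The point of `ℝ^N` obtained from `x'` (coordinates `≠ j`) by inserting `s`
at the `j`-th coordinate. -/
def insertCoord {N : ℕ} (j : Fin N) (x' : {i : Fin N // i ≠ j} → ℝ) (s : ℝ) :
    Fin N → ℝ :=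
  fun i => if h : i = j then s else x' ⟨i, h⟩

/-- `Φ^φ_j(f, I)`: the integral over `I'_j` (with weight `⟨x'_j⟩⁻¹`) of the `φ`-variations
of the `j`-th sections of `f`, where `I = ∏ᵢ [aᵢ, bᵢ]`. -/
def secVar {N : ℕ} (φ : ℝ → ℝ) (f : (Fin N → ℝ) → ℝ) (a b : Fin N → ℝ) (j : Fin N) :
    ℝ≥0∞ :=
  ∫⁻ x' in Set.pi Set.univ (fun i : {i : Fin N // i ≠ j} => Set.Icc (a i.1) (b i.1)),
    phiVar1 φ (a j) (b j) (fun s => f (insertCoord j x' s)) *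
      ENNReal.ofReal ((∏ i : {i : Fin N // i ≠ j}, x' i)⁻¹)

/-- `Φ^φ(f, I) := (∑_j Φ^φ_j(f,I)²)^{1/2}`. -/
def boxPhi {N : ℕ} (φ : ℝ → ℝ) (f : (Fin N → ℝ) → ℝ) (a b : Fin N → ℝ) : ℝ≥0∞ :=
  (∑ j : Fin N, secVar φ f a b j ^ 2) ^ ((1 : ℝ) / 2)

/-- `{J_1, …, J_m}`, with `J_k = ∏ᵢ [c k i, d k i]`, is a partition of `I = ∏ᵢ [aᵢ, bᵢ]`
into non-overlapping `N`-dimensional intervals covering `I`. -/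
def IsBoxPartition {N : ℕ} (a b : Fin N → ℝ) {m : ℕ} (c d : Fin m → Fin N → ℝ) : Prop :=
  (∀ k i, c k i ≤ d k i) ∧
  (⋃ k, Set.pi Set.univ fun i => Set.Icc (c k i) (d k i)) =
    Set.pi Set.univ (fun i => Set.Icc (a i) (b i)) ∧
  Pairwise fun k l =>
    Disjoint (Set.pi Set.univ fun i => Set.Ioo (c k i) (d k i))
      (Set.pi Set.univ fun i => Set.Ioo (c l i) (d l i))

/-- The multidimensional (Tonelli-type) `φ`-variation `V^φ_I[f]` of `f` on
`I = ∏ᵢ [aᵢ, bᵢ]`: the sup of `∑ₖ Φ^φ(f, J_k)` over all partitions of `I` into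
`N`-dimensional intervals. -/
def varOn {N : ℕ} (φ : ℝ → ℝ) (f : (Fin N → ℝ) → ℝ) (a b : Fin N → ℝ) : ℝ≥0∞ :=
  ⨆ (m : ℕ) (c : Fin m → Fin N → ℝ) (d : Fin m → Fin N → ℝ) (_ : IsBoxPartition a b c d),
    ∑ k, boxPhi φ f (c k) (d k)

/-- `V^φ[f]`, the `φ`-variation of `f` over the whole `ℝ^N_+`: the sup of `V^φ_I[f]`
over all intervals `I ⊂ ℝ^N_+`. -/
def totalVar {N : ℕ} (φ : ℝ → ℝ) (f : (Fin N → ℝ) → ℝ) : ℝ≥0∞ :=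
  ⨆ (a : Fin N → ℝ) (b : Fin N → ℝ) (_ : ∀ i, 0 < a i) (_ : ∀ i, a i ≤ b i),
    varOn φ f a b

/-- `f ∈ BV^φ(ℝ^N_+)`: `f` measurable with `V^φ[λ f] < ∞` for some `λ > 0`. -/
def MemBVphi {N : ℕ} (φ : ℝ → ℝ) (f : (Fin N → ℝ) → ℝ) : Prop :=
  Measurable f ∧ ∃ l > (0 : ℝ), totalVar φ (fun x => l * f x) < ⊤

/-- The Mellin-type operator `(T f)(s) := ∫_{ℝ^N_+} K(t) f(st) ⟨t⟩⁻¹ dt`. -/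
def mellinOp {N : ℕ} (K : (Fin N → ℝ) → ℝ) (f : (Fin N → ℝ) → ℝ) (s : Fin N → ℝ) : ℝ :=
  ∫ t in RPos N, K t * f (s * t) * (prodCoord t)⁻¹

/-- `f` belongs to the domain of the operators `T_w`: the defining integrals exist
finitely for every `s ∈ ℝ^N_+` and `w > 0`. -/
def InDomain {N : ℕ} (K : ℝ → (Fin N → ℝ) → ℝ) (f : (Fin N → ℝ) → ℝ) : Prop :=
  ∀ w > (0 : ℝ), ∀ s ∈ RPos N,
    IntegrableOn (fun t => K w t * f (s * t) * (prodCoord t)⁻¹) (RPos N)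

/-- Condition `(K_w.1)` with absolute constant `A`: each `K_w` is measurable and
integrable w.r.t. `⟨t⟩⁻¹ dt`, with `∫ |K_w| dμ ≤ A` and `∫ K_w dμ = 1`. -/
def KernelCond1 {N : ℕ} (K : ℝ → (Fin N → ℝ) → ℝ) (A : ℝ) : Prop :=
  ∀ w > (0 : ℝ), Measurable (K w) ∧
    IntegrableOn (fun t => K w t * (prodCoord t)⁻¹) (RPos N) ∧
    (∫ t in RPos N, |K w t| * (prodCoord t)⁻¹) ≤ A ∧
    (∫ t in RPos N, K w t * (prodCoord t)⁻¹) = 1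

/-- Condition `(K_w.2)`: for every `δ ∈ (0,1)`,
`∫_{|1-t|>δ} |K_w(t)| ⟨t⟩⁻¹ dt → 0` as `w → +∞`. -/
def KernelCond2 {N : ℕ} (K : ℝ → (Fin N → ℝ) → ℝ) : Prop :=
  ∀ δ : ℝ, 0 < δ → δ < 1 →
    Tendsto (fun w => ∫ t in {t ∈ RPos N | δ < distOne t}, |K w t| * (prodCoord t)⁻¹)
      atTop (nhds 0)

/-- The `φ`-modulus of smoothness `ω^φ(f, δ) := sup_{|1-t| ≤ δ} V^φ[τ_t f - f]`. -/
def modSmooth {N : ℕ} (φ : ℝ → ℝ) (f : (Fin N → ℝ) → ℝ) (δ : ℝ) : ℝ≥0∞ :=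
  ⨆ (t : Fin N → ℝ) (_ : t ∈ RPos N) (_ : distOne t ≤ δ),
    totalVar φ (fun s => f (s * t) - f s)

/-- `f` is locally `φ`-absolutely continuous on `ℝ^N_+` (uniformly, in the sense of
Tonelli) with constant `l`. -/
def LocACphiWith {N : ℕ} (φ : ℝ → ℝ) (f : (Fin N → ℝ) → ℝ) (l : ℝ) : Prop :=
  ∀ a b : Fin N → ℝ, (∀ i, 0 < a i) → (∀ i, a i ≤ b i) → ∀ j : Fin N,
    ∀ ε > (0 : ℝ), ∃ δ > (0 : ℝ),
      ∀ᵐ x' ∂(volume.restrict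
          (Set.pi Set.univ (fun i : {i : Fin N // i ≠ j} => Set.Icc (a i.1) (b i.1)))),
        ∀ n : ℕ, ∀ α β : Fin n → ℝ,
          (∀ i, a j ≤ α i ∧ α i ≤ β i ∧ β i ≤ b j) →
          (Pairwise fun i i' =>
            Disjoint (Set.Ioo (α i) (β i)) (Set.Ioo (α i') (β i'))) →
          (∑ i, φ (β i - α i)) < δ →
          (∑ i, φ (l * |f (insertCoord j x' (β i)) - f (insertCoord j x' (α i))|)) < ε

/-- `f ∈ AC^φ(ℝ^N_+)`: `f` is measurable, of bounded `φ`-variation and locally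
`φ`-absolutely continuous on `ℝ^N_+`. -/
def MemACphi {N : ℕ} (φ : ℝ → ℝ) (f : (Fin N → ℝ) → ℝ) : Prop :=
  MemBVphi φ f ∧ ∃ l > (0 : ℝ), LocACphiWith φ f l

/-- `{K_w}` is an `α`-singular kernel: for every `δ ∈ (0,1)`,
`∫_{|1-t|>δ} |K_w(t)| ⟨t⟩⁻¹ dt = O(w^{-α})` as `w → +∞`. -/
def AlphaSingular {N : ℕ} (K : ℝ → (Fin N → ℝ) → ℝ) (α : ℝ) : Prop :=
  ∀ δ : ℝ, 0 < δ → δ < 1 →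
    (fun w => ∫ t in {t ∈ RPos N | δ < distOne t}, |K w t| * (prodCoord t)⁻¹)
      =O[atTop] fun w : ℝ => w ^ (-α)

/-- The Lipschitz class `V^φ Lip_N(α)`: `f ∈ BV^φ(ℝ^N_+)` such that, for some `μ > 0`,
`V^φ[μ(τ_t f - f)] = O(|log t|^α)` as `|1 - t| → 0`. -/
def MemLipAlpha {N : ℕ} (φ : ℝ → ℝ) (α : ℝ) (f : (Fin N → ℝ) → ℝ) : Prop :=
  MemBVphi φ f ∧ ∃ μ > (0 : ℝ), ∃ C > (0 : ℝ), ∃ η > (0 : ℝ),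
    ∀ t ∈ RPos N, distOne t ≤ η →
      totalVar φ (fun x => μ * (f (x * t) - f x)) ≤ ENNReal.ofReal (C * logNorm t ^ α)


/-- A continuous image of the Baire space can be approximated in measure from inside by
compact sets. -/
theorem exists_isCompact_subset_range_le_measure {X : Type*} [TopologicalSpace X] [T2Space X]
    [MeasurableSpace X] [OpensMeasurableSpace X] (μ : Measure X) [IsFiniteMeasure μ]
    {f : (ℕ → ℕ) → X} (hf : Continuous f) {r : ℝ≥0∞} (hr : r < μ (range f)) :
    ∃ C, IsCompact C ∧ C ⊆ range f ∧ r ≤ μ C := by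
  have step : ∀ (S : {S : Set (ℕ → ℕ) // r < μ (f '' S)}) (k : ℕ),
      ∃ n, r < μ (f '' (S.1 ∩ {x | x k ≤ n})) := by
    rintro ⟨S, hS⟩ k
    have hU : f '' S = ⋃ n : ℕ, f '' (S ∩ {x | x k ≤ n}) := by
      rw [← image_iUnion, ← inter_iUnion]
      congr 1
      ext x
      simp only [mem_inter_iff, mem_iUnion, mem_ofPred_eq]
      exact ⟨fun h => ⟨h, x k, le_rfl⟩, fun h => h.1⟩
    have hmono : Monotone fun n : ℕ => f '' (S ∩ {x | x k ≤ n}) := fun m n hmn =>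
      image_mono (inter_subset_inter_right _ fun x (hx : x k ≤ m) => hx.trans hmn)
    rw [hU, hmono.measure_iUnion, lt_iSup_iff] at hS
    exact hS
  choose b hb using step
  let S : ℕ → {S : Set (ℕ → ℕ) // r < μ (f '' S)} := fun k =>
    Nat.rec ⟨univ, by rwa [image_univ]⟩ (fun k T => ⟨_, hb T k⟩) k
  let n : ℕ → ℕ := fun k => b (S k) k
  have hS : ∀ k, (S k).1 = {x | ∀ i < k, x i ≤ n i} := by
    intro k
    induction k with
    | zero => ext x; simp [S]
    | succ k ih =>
      have : (S (k + 1)).1 = (S k).1 ∩ {x | x k ≤ n k} := rfl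
      rw [this, ih]
      ext x
      simp only [mem_inter_iff, mem_ofPred_eq, Nat.lt_succ_iff_lt_or_eq]
      constructor
      · rintro ⟨h1, h2⟩ i (hi | rfl)
        exacts [h1 i hi, h2]
      · exact fun h => ⟨fun i hi => h i (Or.inl hi), h k (Or.inr rfl)⟩
  have hC : IsCompact (Set.pi univ fun i => Iic (n i)) :=
    isCompact_univ_pi fun i => (finite_Iic (n i)).isCompact
  refine ⟨f '' Set.pi univ fun i => Iic (n i), hC.image hf, image_subset_range _ _, ?_⟩
  have hsub : ⋂ k, closure (f '' (S k).1) ⊆ f '' Set.pi univ fun i => Iic (n i) := by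
    intro y hy
    by_contra hyC
    obtain ⟨U, V, hU, hV, hCU, hyV, hUV⟩ :=
      SeparatedNhds.of_isCompact_isCompact (hC.image hf) isCompact_singleton
        (disjoint_singleton_right.2 hyC)
    obtain ⟨k, hk⟩ : ∃ k, f '' (S k).1 ⊆ U := by
      by_contra! hne
      have : ∀ k, ∃ x ∈ (S k).1, f x ∉ U := by
        intro k
        obtain ⟨_, ⟨x, hx, rfl⟩, hxU⟩ := not_subset.1 (hne k)
        exact ⟨x, hx, hxU⟩
      choose x hx hxU using this
      obtain ⟨z, hz, ψ, hψ, hlim⟩ := hC.tendsto_subseq (x := fun k i => min (x k i) (n i))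
        fun k i _ => mem_Iic.2 (min_le_right _ _)
      have hlim' : Tendsto (fun m => x (ψ m)) atTop (nhds z) := by
        rw [tendsto_pi_nhds] at hlim ⊢
        intro i
        refine (hlim i).congr' ?_
        filter_upwards [eventually_gt_atTop i] with m hm
        have := hx (ψ m)
        rw [hS] at this
        exact min_eq_left (this i (hm.trans_le (hψ.id_le m)))
      have hzU : f z ∈ U := hCU (mem_image_of_mem f hz)
      obtain ⟨m, hm⟩ := (((hf.tendsto z).comp hlim').eventually (hU.mem_nhds hzU)).exists
      exact hxU _ hm
    obtain ⟨w, hwV, hw⟩ := mem_closure_iff.1 (mem_iInter.1 hy k) V hV (hyV rfl)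
    exact hUV.le_bot ⟨hk hw, hwV⟩
  refine le_trans ?_ (measure_mono hsub)
  have hanti : Antitone fun k => closure (f '' (S k).1) := fun k l hkl =>
    closure_mono (image_mono (by
      rw [hS, hS]
      exact fun x hx i hi => hx i (hi.trans_le hkl)))
  rw [hanti.measure_iInter (fun k => isClosed_closure.measurableSet.nullMeasurableSet)
    ⟨0, measure_ne_top _ _⟩]
  exact le_iInf fun k => (S k).2.le.trans (measure_mono subset_closure)

/-- Analytic sets are universally measurable. -/
theorem MeasureTheory.AnalyticSet.nullMeasurableSet {X : Type*} [TopologicalSpace X] [T2Space X]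
    [MeasurableSpace X] [OpensMeasurableSpace X] {s : Set X} (hs : AnalyticSet s)
    (μ : Measure X) [SFinite μ] : NullMeasurableSet s μ := by
  obtain ⟨ν, hν, hμν, -⟩ := exists_isFiniteMeasure_absolutelyContinuous μ
  refine NullMeasurableSet.mono_ac ?_ hμν
  rw [AnalyticSet] at hs
  rcases hs with rfl | ⟨f, hf, rfl⟩
  · exact nullMeasurableSet_empty
  rcases eq_or_ne (ν (range f)) 0 with h0 | h0
  · exact NullMeasurableSet.of_null h0
  obtain ⟨u, -, hu, hlim⟩ := exists_seq_strictMono_tendsto' (pos_iff_ne_zero.2 h0)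
  choose C hC hCs hCu using fun n =>
    exists_isCompact_subset_range_le_measure ν hf (hu n).2
  have hB : MeasurableSet (⋃ n, C n) := .iUnion fun n => (hC n).measurableSet
  have hBs : ⋃ n, C n ⊆ range f := iUnion_subset hCs
  have hle : ν (range f) ≤ ν (⋃ n, C n) :=
    le_of_tendsto' hlim fun n => (hCu n).trans (measure_mono (subset_iUnion C n))
  have hnull : ν (range f \ ⋃ n, C n) = 0 := by
    refine measure_mono_null (sdiff_subset_sdiff_left (subset_toMeasurable ν _)) ?_
    rw [measure_sdiff (hBs.trans (subset_toMeasurable ν _)) hB.nullMeasurableSet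
      (measure_ne_top _ _), measure_toMeasurable]
    exact tsub_eq_zero_of_le hle
  rw [← union_sdiff_cancel hBs]
  exact hB.nullMeasurableSet.union (NullMeasurableSet.of_null hnull)

/-- The supremum over a measurable set of parameters of a jointly measurable function is
universally measurable. -/
theorem Measurable.aemeasurable_biSup_right {X Y : Type*} [MeasurableSpace X] [StandardBorelSpace X]
    [MeasurableSpace Y] [StandardBorelSpace Y] {G : X × Y → ℝ≥0∞} (hG : Measurable G)
    {M : Set Y} (hM : MeasurableSet M) (μ : Measure X) [SFinite μ] :
    AEMeasurable (fun x => ⨆ y ∈ M, G (x, y)) μ := by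
  let := upgradeStandardBorel X
  refine NullMeasurable.aemeasurable ?_
  rw [nullMeasurable_iff_eventuallyMeasurable]
  refine @measurable_of_Ioi ℝ≥0∞ X _ _ _ (_) _ _ _ _ fun r => ?_
  have : (fun x => ⨆ y ∈ M, G (x, y)) ⁻¹' Ioi r =
      Prod.fst '' ((G ⁻¹' Ioi r) ∩ (univ ×ˢ M)) := by
    ext x
    simp only [mem_preimage, mem_Ioi, lt_iSup_iff, mem_image, mem_inter_iff, mem_prod, mem_univ,
      true_and, Prod.exists, exists_and_right, exists_eq_right]
    exact exists_congr fun y => ⟨fun ⟨h, h'⟩ => ⟨h', h⟩, fun ⟨h, h'⟩ => ⟨h', h⟩⟩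
  rw [this]
  exact (((hG measurableSet_Ioi).inter
    (MeasurableSet.univ.prod hM)).analyticSet_image measurable_fst).nullMeasurableSet μ

namespace IsPhiFun

variable {φ : ℝ → ℝ}

theorem map_zero (hφ : IsPhiFun φ) : φ 0 = 0 := (hφ.2.2.1 0 le_rfl).2 rfl

theorem map_mul_le (hφ : IsPhiFun φ) {c x : ℝ} (hc : 0 ≤ c) (hc1 : c ≤ 1) (hx : 0 ≤ x) :
    φ (c * x) ≤ c * φ x := by
  have := hφ.1.2 (mem_Ici.2 hx) (mem_Ici.2 le_rfl) hc (sub_nonneg.2 hc1) (by ring)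
  simpa [hφ.map_zero] using this

theorem monotoneOn (hφ : IsPhiFun φ) : MonotoneOn φ (Ici 0) := by
  intro x hx y hy hxy
  rw [mem_Ici] at hx hy
  rcases hy.eq_or_lt with rfl | hy'
  · rw [le_antisymm hxy hx]
  · have hc : x / y ≤ 1 := div_le_one_of_le₀ hxy hy
    have h := hφ.map_mul_le (div_nonneg hx hy) hc hy
    rw [div_mul_cancel₀ _ hy'.ne'] at h
    exact h.trans (mul_le_of_le_one_left (hφ.2.1 y hy) hc)

theorem convexOn_comp_abs (hφ : IsPhiFun φ) : ConvexOn ℝ univ fun x => φ |x| := by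
  refine ⟨convex_univ, fun x _ y _ a b ha hb hab => ?_⟩
  refine le_trans ?_ (hφ.1.2 (mem_Ici.2 (abs_nonneg x)) (mem_Ici.2 (abs_nonneg y)) ha hb hab)
  refine hφ.monotoneOn (mem_Ici.2 (abs_nonneg _)) (mem_Ici.2 (by positivity)) ?_
  simpa [abs_mul, abs_of_nonneg ha, abs_of_nonneg hb] using abs_add_le (a * x) (b * y)

theorem continuous_comp_abs (hφ : IsPhiFun φ) : Continuous fun x => φ |x| := by
  rw [← continuousOn_univ]
  exact hφ.convexOn_comp_abs.continuousOn isOpen_univ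

theorem measurable_ofReal_comp_abs (hφ : IsPhiFun φ) :
    Measurable fun x => ENNReal.ofReal (φ |x|) :=
  hφ.continuous_comp_abs.measurable.ennreal_ofReal

/-- Jensen's inequality for a measure of total mass at most `A`. -/
theorem ofReal_abs_integral_le (hφ : IsPhiFun φ) {A : ℝ} (hA : 0 < A) {α : Type*}
    [MeasurableSpace α] {ν : Measure α} [IsFiniteMeasure ν] (hν : ν univ ≤ ENNReal.ofReal A)
    {h : α → ℝ} (hh : Integrable h ν) :
    ENNReal.ofReal (φ |∫ t, h t ∂ν|) ≤
      ENNReal.ofReal A⁻¹ * ∫⁻ t, ENNReal.ofReal (φ |A * h t|) ∂ν := by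
  rcases eq_zero_or_neZero ν with rfl | hν0
  · simp [hφ.map_zero]
  have hm : 0 < ν.real univ := by
    rw [Measure.real, ENNReal.toReal_pos_iff]
    exact ⟨pos_iff_ne_zero.2 (NeZero.ne _), measure_lt_top _ _⟩
  set m := ν.real univ with hm_def
  have hmA : m ≤ A := ENNReal.toReal_le_of_le_ofReal hA.le hν
  by_cases hfin : ∫⁻ t, ENNReal.ofReal (φ |A * h t|) ∂ν = ∞
  · rw [hfin, ENNReal.mul_top (by simpa using hA)]
    exact le_top
  have hmeas : ∀ c : ℝ, AEStronglyMeasurable (fun t => φ |c * h t|) ν := fun c =>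
    hφ.continuous_comp_abs.comp_aestronglyMeasurable (hh.1.const_mul c)
  have hnn : ∀ x : ℝ, 0 ≤ φ |x| := fun x => hφ.2.1 _ (abs_nonneg x)
  have hint : Integrable (fun t => φ |A * h t|) ν := by
    refine ⟨hmeas A, ?_⟩
    rw [hasFiniteIntegral_iff_ofReal (Eventually.of_forall fun t => hnn _)]
    exact lt_top_iff_ne_top.2 hfin
  have hle : ∀ t, φ |m * h t| ≤ m / A * φ |A * h t| := by
    intro t
    refine le_trans (le_of_eq ?_) (hφ.map_mul_le (by positivity) (div_le_one_of_le₀ hmA hA.le)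
      (abs_nonneg _))
    congr 1
    rw [abs_mul, abs_mul, abs_of_pos hm, abs_of_pos hA]
    field_simp
  have hint' : Integrable (fun t => φ |m * h t|) ν :=
    (hint.const_mul (m / A)).mono' (hmeas m) (Eventually.of_forall fun t => by
      rw [Real.norm_eq_abs, abs_of_nonneg (hnn _)]
      exact hle t)
  have key := hφ.convexOn_comp_abs.map_average_le hφ.continuous_comp_abs.continuousOn
    isClosed_univ (f := fun t => m * h t) (μ := ν) (by simp) (hh.const_mul m) hint'
  rw [average_eq, average_eq, integral_const_mul, smul_eq_mul, smul_eq_mul, ← hm_def,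
    inv_mul_cancel_left₀ hm.ne'] at key
  rw [← ofReal_integral_eq_lintegral_ofReal hint (Eventually.of_forall fun t => hnn _),
    ← ENNReal.ofReal_mul (by positivity)]
  refine ENNReal.ofReal_le_ofReal (key.trans ?_)
  calc m⁻¹ * ∫ t, φ |m * h t| ∂ν ≤ m⁻¹ * ∫ t, m / A * φ |A * h t| ∂ν := by
        exact mul_le_mul_of_nonneg_left (integral_mono hint' (hint.const_mul _) hle)
          (by positivity)
    _ = A⁻¹ * ∫ t, φ |A * h t| ∂ν := by
        rw [integral_const_mul]
        field_simp

theorem ofReal_abs_sub_le (hφ : IsPhiFun φ) (x y : ℝ) :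
    ENNReal.ofReal (φ |x - y|) ≤
      (2⁻¹ : ℝ≥0∞) * ENNReal.ofReal (φ |2 * x|) +
        (2⁻¹ : ℝ≥0∞) * ENNReal.ofReal (φ |2 * y|) := by
  have h := hφ.convexOn_comp_abs.2 (mem_univ (2 * x)) (mem_univ (-(2 * y)))
    (show (0 : ℝ) ≤ 2⁻¹ by norm_num) (show (0 : ℝ) ≤ 2⁻¹ by norm_num) (by norm_num)
  have e : 2⁻¹ * (2 * x) + 2⁻¹ * (-(2 * y)) = x - y := by ring
  have e2 : (2⁻¹ : ℝ≥0∞) = ENNReal.ofReal 2⁻¹ := by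
    rw [ENNReal.ofReal_inv_of_pos two_pos, ENNReal.ofReal_ofNat]
  simp only [smul_eq_mul, e, abs_neg] at h
  have hnn : ∀ x : ℝ, 0 ≤ φ |x| := fun x => hφ.2.1 _ (abs_nonneg x)
  have p1 := hnn (2 * x)
  have p2 := hnn (2 * y)
  rw [e2, ← ENNReal.ofReal_mul (by norm_num), ← ENNReal.ofReal_mul (by norm_num),
    ← ENNReal.ofReal_add (by positivity) (by positivity)]
  exact ENNReal.ofReal_le_ofReal h

end IsPhiFun

/-- Minkowski's integral inequality for the Euclidean norm. -/
theorem ENNReal.sum_sq_lintegral_rpow_half_le {ι α : Type*} [Fintype ι] [MeasurableSpace α]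
    (ν : Measure α) {h : ι → α → ℝ≥0∞} (hh : ∀ j, AEMeasurable (h j) ν) :
    (∑ j, (∫⁻ t, h j t ∂ν) ^ 2) ^ ((1 : ℝ) / 2) ≤
      ∫⁻ t, (∑ j, h j t ^ 2) ^ ((1 : ℝ) / 2) ∂ν := by
  set a : ι → ℝ≥0∞ := fun j => ∫⁻ t, h j t ∂ν with ha
  set S := (∑ j, a j ^ 2) ^ ((1 : ℝ) / 2) with hS
  have hSS : S * S = ∑ j, a j ^ 2 := by
    rw [hS, ← ENNReal.rpow_add_of_nonneg _ _ (by norm_num) (by norm_num)]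
    norm_num
  have hle : ∀ j t, h j t ≤ (∑ j, h j t ^ 2) ^ ((1 : ℝ) / 2) := by
    intro j t
    calc h j t = (h j t ^ 2) ^ ((1 : ℝ) / 2) := by
          rw [← ENNReal.rpow_natCast_mul]; norm_num
      _ ≤ _ := ENNReal.rpow_le_rpow
          (Finset.single_le_sum (f := fun j => h j t ^ 2) (fun _ _ => zero_le) (Finset.mem_univ j))
          (by norm_num)
  rcases eq_or_ne S 0 with h0 | h0
  · rw [h0]; exact zero_le
  rcases eq_or_ne S ∞ with hT | hT
  · obtain ⟨j, hj⟩ : ∃ j, a j = ∞ := by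
      have : ∑ j, a j ^ 2 = ∞ := by rw [← hSS, hT]; simp
      obtain ⟨j, -, hj⟩ := ENNReal.sum_eq_top.1 this
      exact ⟨j, by simpa using hj⟩
    refine le_top.trans (hj.symm.le.trans (lintegral_mono fun t => hle j t))
  refine (ENNReal.mul_le_mul_iff_right h0 hT).1 ?_
  calc S * S = ∑ j, a j * ∫⁻ t, h j t ∂ν := by
        rw [hSS]; exact Finset.sum_congr rfl fun j _ => sq (a j)
    _ ≤ ∑ j, ∫⁻ t, a j * h j t ∂ν :=
        Finset.sum_le_sum fun j _ => lintegral_const_mul_le _ _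
    _ = ∫⁻ t, ∑ j, a j * h j t ∂ν :=
        (lintegral_finsetSum' _ fun j _ => (hh j).const_mul _).symm
    _ ≤ ∫⁻ t, S * (∑ j, h j t ^ 2) ^ ((1 : ℝ) / 2) ∂ν := by
        refine lintegral_mono fun t => ?_
        have := ENNReal.inner_le_Lp_mul_Lq Finset.univ a (fun j => h j t)
          (p := 2) (q := 2) Real.HolderConjugate.two_two
        simpa only [ENNReal.rpow_ofNat] using this
    _ = S * ∫⁻ t, (∑ j, h j t ^ 2) ^ ((1 : ℝ) / 2) ∂ν := lintegral_const_mul' _ _ hT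

theorem IsPhiFun.aemeasurable_phiVar1 {φ : ℝ → ℝ} (hφ : IsPhiFun φ) {X : Type*}
    [MeasurableSpace X] [StandardBorelSpace X] {H : X → ℝ → ℝ}
    (hH : Measurable (Function.uncurry H)) (μ : Measure X) [SFinite μ] (a b : ℝ) :
    AEMeasurable (fun x => phiVar1 φ a b (H x)) μ := by
  have hM : ∀ n : ℕ, MeasurableSet
      {u : Fin (n + 1) → ℝ | Monotone u ∧ u 0 = a ∧ u (Fin.last n) = b} := fun n =>
    (isClosed_monotone.inter ((isClosed_eq (continuous_apply _) continuous_const).inter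
      (isClosed_eq (continuous_apply _) continuous_const))).measurableSet
  have heq : (fun x => phiVar1 φ a b (H x)) = fun x => ⨆ n : ℕ,
      ⨆ u ∈ {u : Fin (n + 1) → ℝ | Monotone u ∧ u 0 = a ∧ u (Fin.last n) = b},
        ∑ i : Fin n, ENNReal.ofReal (φ |H x (u i.succ) - H x (u i.castSucc)|) := by
    funext x
    simp only [phiVar1, mem_ofPred_eq, iSup_and]
  rw [heq]
  refine AEMeasurable.iSup fun n => ?_
  refine Measurable.aemeasurable_biSup_right (G := fun p : X × (Fin (n + 1) → ℝ) =>
    ∑ i : Fin n, ENNReal.ofReal (φ |H p.1 (p.2 i.succ) - H p.1 (p.2 i.castSucc)|)) ?_ (hM n) μ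
  refine Finset.measurable_sum _ fun i _ => hφ.measurable_ofReal_comp_abs.comp ?_
  have hev : ∀ k : Fin (n + 1), Measurable fun p : X × (Fin (n + 1) → ℝ) => H p.1 (p.2 k) :=
    fun k => hH.comp (measurable_fst.prodMk ((measurable_pi_apply k).comp measurable_snd))
  exact (hev _).sub (hev _)

theorem phiVar1_le_lintegral {φ : ℝ → ℝ} {T : Type*} [MeasurableSpace T] {ν : Measure T}
    {a b : ℝ} {g : ℝ → ℝ} {G : T → ℝ → ℝ}
    (hG : ∀ p q, Measurable fun t => ENNReal.ofReal (φ |G t p - G t q|))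
    (h : ∀ p ∈ Icc a b, ∀ q ∈ Icc a b, ENNReal.ofReal (φ |g p - g q|) ≤
      ∫⁻ t, ENNReal.ofReal (φ |G t p - G t q|) ∂ν) :
    phiVar1 φ a b g ≤ ∫⁻ t, phiVar1 φ a b (G t) ∂ν := by
  refine iSup_le fun n => iSup_le fun u => iSup_le fun hu => iSup_le fun h0 => iSup_le fun h1 => ?_
  have hmem : ∀ k, u k ∈ Icc a b := fun k =>
    ⟨h0 ▸ hu (Fin.zero_le k), h1 ▸ hu (Fin.le_last k)⟩
  calc ∑ i : Fin n, ENNReal.ofReal (φ |g (u i.succ) - g (u i.castSucc)|)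
      ≤ ∑ i : Fin n, ∫⁻ t, ENNReal.ofReal (φ |G t (u i.succ) - G t (u i.castSucc)|) ∂ν :=
        Finset.sum_le_sum fun i _ => h _ (hmem _) _ (hmem _)
    _ = ∫⁻ t, ∑ i : Fin n, ENNReal.ofReal (φ |G t (u i.succ) - G t (u i.castSucc)|) ∂ν :=
        (lintegral_finsetSum _ fun i _ => hG _ _).symm
    _ ≤ ∫⁻ t, phiVar1 φ a b (G t) ∂ν := lintegral_mono fun t =>
        le_iSup_of_le n <| le_iSup_of_le u <| le_iSup_of_le hu <| le_iSup_of_le h0 <|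
          le_iSup_of_le h1 le_rfl

theorem measurable_insertCoord {N : ℕ} (j : Fin N) :
    Measurable fun p : ({i : Fin N // i ≠ j} → ℝ) × ℝ => insertCoord j p.1 p.2 := by
  refine measurable_pi_lambda _ fun i => ?_
  by_cases h : i = j
  · simpa only [insertCoord, h, dite_true] using measurable_snd
  · simp only [insertCoord, h, dite_false]
    fun_prop

section SuperpositionBound

variable {N : ℕ} {φ : ℝ → ℝ} {T : Type*} [MeasurableSpace T] [StandardBorelSpace T]
  {ν : Measure T} [SFinite ν] {g : (Fin N → ℝ) → ℝ} {G : T → (Fin N → ℝ) → ℝ}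

theorem IsPhiFun.aemeasurable_phiVar1_section (hφ : IsPhiFun φ)
    (hG : Measurable (Function.uncurry G)) (a b : ℝ) (j : Fin N)
    (μ : Measure ({i : Fin N // i ≠ j} → ℝ)) [SFinite μ] :
    AEMeasurable (fun p : ({i : Fin N // i ≠ j} → ℝ) × T =>
      phiVar1 φ a b (fun s => G p.2 (insertCoord j p.1 s)) *
        ENNReal.ofReal ((∏ i : {i : Fin N // i ≠ j}, p.1 i)⁻¹)) (μ.prod ν) := by
  refine AEMeasurable.mul (hφ.aemeasurable_phiVar1 ?_ _ a b) ?_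
  · exact hG.comp ((measurable_snd.comp measurable_fst).prodMk
      ((measurable_insertCoord j).comp
        ((measurable_fst.comp measurable_fst).prodMk measurable_snd)))
  · exact (Measurable.ennreal_ofReal (by fun_prop)).aemeasurable

theorem IsPhiFun.aemeasurable_secVar (hφ : IsPhiFun φ) (hG : Measurable (Function.uncurry G))
    (a b : Fin N → ℝ) (j : Fin N) : AEMeasurable (fun t => secVar φ (G t) a b j) ν :=
  (hφ.aemeasurable_phiVar1_section hG (a j) (b j) j _).lintegral_prod_left'

theorem IsPhiFun.secVar_le_lintegral (hφ : IsPhiFun φ) (hG : Measurable (Function.uncurry G))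
    (h : ∀ p ∈ RPos N, ∀ q ∈ RPos N, ENNReal.ofReal (φ |g p - g q|) ≤
      ∫⁻ t, ENNReal.ofReal (φ |G t p - G t q|) ∂ν)
    {a b : Fin N → ℝ} (ha : ∀ i, 0 < a i) (j : Fin N) :
    secVar φ g a b j ≤ ∫⁻ t, secVar φ (G t) a b j ∂ν := by
  unfold secVar
  have hbox : MeasurableSet
      (Set.pi univ fun i : {i : Fin N // i ≠ j} => Icc (a i.1) (b i.1)) :=
    MeasurableSet.univ_pi fun i => measurableSet_Icc
  rw [← lintegral_lintegral_swap (hφ.aemeasurable_phiVar1_section hG (a j) (b j) j _)]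
  refine setLIntegral_mono' hbox fun x hx => ?_
  rw [lintegral_mul_const' _ _ ENNReal.ofReal_ne_top]
  gcongr
  have hpos : ∀ s ∈ Icc (a j) (b j), insertCoord j x s ∈ RPos N := by
    intro s hs i
    by_cases hi : i = j
    · simpa only [insertCoord, hi, dite_true] using (ha j).trans_le hs.1
    · simpa only [insertCoord, hi, dite_false] using (ha i).trans_le (hx ⟨i, hi⟩ (mem_univ _)).1
  have hm : ∀ p, Measurable fun t => G t p := fun p => hG.comp (measurable_id.prodMk measurable_const)
  exact phiVar1_le_lintegral
    (fun p q => hφ.measurable_ofReal_comp_abs.comp ((hm _).sub (hm _)))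
    fun p hp q hq => h _ (hpos p hp) _ (hpos q hq)

theorem IsPhiFun.aemeasurable_boxPhi (hφ : IsPhiFun φ) (hG : Measurable (Function.uncurry G))
    (a b : Fin N → ℝ) : AEMeasurable (fun t => boxPhi φ (G t) a b) ν :=
  (Finset.aemeasurable_fun_sum _ fun j _ =>
    (hφ.aemeasurable_secVar hG a b j).pow_const 2).pow_const _

theorem IsPhiFun.boxPhi_le_lintegral (hφ : IsPhiFun φ) (hG : Measurable (Function.uncurry G))
    (h : ∀ p ∈ RPos N, ∀ q ∈ RPos N, ENNReal.ofReal (φ |g p - g q|) ≤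
      ∫⁻ t, ENNReal.ofReal (φ |G t p - G t q|) ∂ν)
    {a b : Fin N → ℝ} (ha : ∀ i, 0 < a i) :
    boxPhi φ g a b ≤ ∫⁻ t, boxPhi φ (G t) a b ∂ν := by
  refine le_trans ?_ (ENNReal.sum_sq_lintegral_rpow_half_le ν
    fun j => hφ.aemeasurable_secVar hG a b j)
  unfold boxPhi
  gcongr with j
  exact hφ.secVar_le_lintegral hG h ha j

theorem IsBoxPartition.pos {a b : Fin N → ℝ} {m : ℕ} {c d : Fin m → Fin N → ℝ}
    (hp : IsBoxPartition a b c d) (ha : ∀ i, 0 < a i) (k : Fin m) (i : Fin N) : 0 < c k i := by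
  have hmem : c k ∈ ⋃ k, Set.pi univ fun i => Icc (c k i) (d k i) :=
    mem_iUnion.2 ⟨k, fun i _ => ⟨le_rfl, hp.1 k i⟩⟩
  rw [hp.2.1] at hmem
  exact (ha i).trans_le (hmem i (mem_univ i)).1

/-- If the `φ`-increments of `g` are dominated by the averages of those of a measurable family
`G`, then so is the total `φ`-variation. -/
theorem IsPhiFun.totalVar_le_lintegral (hφ : IsPhiFun φ) (hG : Measurable (Function.uncurry G))
    (h : ∀ p ∈ RPos N, ∀ q ∈ RPos N, ENNReal.ofReal (φ |g p - g q|) ≤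
      ∫⁻ t, ENNReal.ofReal (φ |G t p - G t q|) ∂ν) :
    totalVar φ g ≤ ∫⁻ t, totalVar φ (G t) ∂ν := by
  refine iSup_le fun a => iSup_le fun b => iSup_le fun ha => iSup_le fun hab =>
    iSup_le fun m => iSup_le fun c => iSup_le fun d => iSup_le fun hp => ?_
  calc ∑ k, boxPhi φ g (c k) (d k)
      ≤ ∑ k, ∫⁻ t, boxPhi φ (G t) (c k) (d k) ∂ν :=
        Finset.sum_le_sum fun k _ => hφ.boxPhi_le_lintegral hG h (hp.pos ha k)
    _ = ∫⁻ t, ∑ k, boxPhi φ (G t) (c k) (d k) ∂ν :=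
        (lintegral_finsetSum' _ fun k _ => hφ.aemeasurable_boxPhi hG (c k) (d k)).symm
    _ ≤ ∫⁻ t, totalVar φ (G t) ∂ν := lintegral_mono fun t =>
        le_iSup_of_le a <| le_iSup_of_le b <| le_iSup_of_le ha <| le_iSup_of_le hab <|
          le_iSup_of_le m <| le_iSup_of_le c <| le_iSup_of_le d <| le_iSup_of_le hp le_rfl

end SuperpositionBound

section Scaling

variable {N : ℕ} {t : Fin N → ℝ}

theorem insertCoord_mul (j : Fin N) (x : {i : Fin N // i ≠ j} → ℝ) (s : ℝ) (t : Fin N → ℝ) :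
    insertCoord j x s * t = insertCoord j (fun i => x i * t i.1) (s * t j) := by
  funext i
  by_cases hi : i = j
  · subst hi; simp [insertCoord]
  · simp [insertCoord, hi]

theorem phiVar1_comp_mul_le {φ : ℝ → ℝ} (a b : ℝ) (g : ℝ → ℝ) {r : ℝ} (hr : 0 ≤ r) :
    phiVar1 φ a b (fun s => g (s * r)) ≤ phiVar1 φ (a * r) (b * r) g := by
  refine iSup_le fun n => iSup_le fun u => iSup_le fun hu => iSup_le fun h0 => iSup_le fun h1 => ?_
  refine le_iSup_of_le n <| le_iSup_of_le (fun k => u k * r) <| le_iSup_of_le ?_ <|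
    le_iSup_of_le (congrArg (· * r) h0) <| le_iSup_of_le (congrArg (· * r) h1) le_rfl
  exact fun k l hkl => mul_le_mul_of_nonneg_right (hu hkl) hr

theorem lintegral_comp_mul_mul_prod_ofReal {ι : Type*} [Fintype ι] {D : ι → ℝ}
    (hD : ∀ i, 0 < D i) (F : (ι → ℝ) → ℝ≥0∞) :
    ∫⁻ y, F y = ∫⁻ x : ι → ℝ, F (fun i => x i * D i) * ENNReal.ofReal (∏ i, D i) := by
  classical
  let e : (ι → ℝ) ≃ᵐ (ι → ℝ) :=
    MeasurableEquiv.piCongrRight fun i => MeasurableEquiv.mulRight₀ (D i) (hD i).ne'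
  have hdet : (Matrix.diagonal D).det = ∏ i, D i := Matrix.det_diagonal
  have hprod : 0 < ∏ i, D i := Finset.prod_pos fun i _ => hD i
  have he : ⇑(Matrix.toLin' (Matrix.diagonal D)) = e := by
    funext x i
    rw [Matrix.toLin'_apply, Matrix.mulVec_diagonal]
    exact mul_comm _ _
  have hvol := Real.smul_map_diagonal_volume_pi (D := D) (by rw [hdet]; exact hprod.ne')
  rw [hdet, abs_of_pos hprod, he] at hvol
  rw [← hvol, lintegral_smul_measure, lintegral_map_equiv,
    lintegral_mul_const' _ _ ENNReal.ofReal_ne_top, smul_eq_mul, mul_comm, hvol]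
  rfl

theorem mul_mem_pi_Icc_iff (ht : ∀ i, 0 < t i) {ι : Type*} (v : ι → Fin N) (a b : Fin N → ℝ)
    (x : ι → ℝ) :
    ((fun i => x i * t (v i)) ∈ Set.pi univ fun i => Icc ((a * t) (v i)) ((b * t) (v i))) ↔
      x ∈ Set.pi univ fun i => Icc (a (v i)) (b (v i)) := by
  simp only [mem_univ_pi, mem_Icc, Pi.mul_apply, mul_le_mul_iff_left₀ (ht _)]

theorem secVar_comp_mul_le {φ : ℝ → ℝ} (ht : t ∈ RPos N) (h : (Fin N → ℝ) → ℝ)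
    (a b : Fin N → ℝ) (j : Fin N) :
    secVar φ (fun s => h (s * t)) a b j ≤ secVar φ h (a * t) (b * t) j := by
  unfold secVar
  rw [← lintegral_indicator (MeasurableSet.univ_pi fun i => measurableSet_Icc),
    ← lintegral_indicator (MeasurableSet.univ_pi fun i => measurableSet_Icc)]
  refine le_of_le_of_eq ?_ (lintegral_comp_mul_mul_prod_ofReal
    (D := fun i : {i : Fin N // i ≠ j} => t i.1) (fun i => ht i.1) _).symm
  refine lintegral_mono fun x => ?_
  have hmem := mul_mem_pi_Icc_iff ht (fun i : {i : Fin N // i ≠ j} => i.1) a b x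
  by_cases hx : x ∈ Set.pi univ fun i : {i : Fin N // i ≠ j} => Icc (a i.1) (b i.1)
  · have hprod : 0 < ∏ i : {i : Fin N // i ≠ j}, t i.1 := Finset.prod_pos fun i _ => ht i.1
    rw [indicator_of_mem hx, indicator_of_mem (hmem.2 hx), mul_assoc,
      ← ENNReal.ofReal_mul' hprod.le, Finset.prod_mul_distrib, mul_inv,
      inv_mul_cancel_right₀ hprod.ne']
    refine mul_le_mul_left ?_ _
    simp only [insertCoord_mul]
    exact phiVar1_comp_mul_le (a j) (b j)
      (fun s => h (insertCoord j (fun i => x i * t i.1) s)) (ht j).le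
  · rw [indicator_of_notMem hx]
    exact zero_le

theorem IsBoxPartition.mul {a b : Fin N → ℝ} {m : ℕ} {c d : Fin m → Fin N → ℝ}
    (hp : IsBoxPartition a b c d) (ht : t ∈ RPos N) :
    IsBoxPartition (a * t) (b * t) (fun k => c k * t) fun k => d k * t := by
  have hdiv : ∀ y : Fin N → ℝ, ∃ x : Fin N → ℝ, y = fun i => x i * t i := fun y =>
    ⟨fun i => y i / t i, funext fun i => (div_mul_cancel₀ _ (ht i).ne').symm⟩
  refine ⟨fun k i => mul_le_mul_of_nonneg_right (hp.1 k i) (ht i).le, ?_, fun k l hkl => ?_⟩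
  · ext y
    obtain ⟨x, rfl⟩ := hdiv y
    have hx := Set.ext_iff.1 hp.2.1 x
    rw [mem_iUnion] at hx ⊢
    exact ((exists_congr fun k => mul_mem_pi_Icc_iff ht id (c k) (d k) x).trans hx).trans
      (mul_mem_pi_Icc_iff ht id a b x).symm
  · change Disjoint _ _
    rw [Set.disjoint_left]
    intro y hk hl
    obtain ⟨x, rfl⟩ := hdiv y
    simp only [mem_univ_pi, mem_Ioo, Pi.mul_apply, mul_lt_mul_iff_left₀ (ht _)] at hk hl
    exact (Set.disjoint_left.1 (hp.2.2 hkl)) (fun i _ => hk i) fun i _ => hl i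

/-- The total `φ`-variation does not increase under homothetic operators. -/
theorem totalVar_comp_mul_le (φ : ℝ → ℝ) (ht : t ∈ RPos N) (h : (Fin N → ℝ) → ℝ) :
    totalVar φ (fun s => h (s * t)) ≤ totalVar φ h := by
  refine iSup_le fun a => iSup_le fun b => iSup_le fun ha => iSup_le fun hab =>
    iSup_le fun m => iSup_le fun c => iSup_le fun d => iSup_le fun hp => ?_
  refine le_iSup_of_le (a * t) <| le_iSup_of_le (b * t) <|
    le_iSup_of_le (fun i => mul_pos (ha i) (ht i)) <|
    le_iSup_of_le (fun i => mul_le_mul_of_nonneg_right (hab i) (ht i).le) <|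
    le_iSup_of_le m <| le_iSup_of_le _ <| le_iSup_of_le _ <| le_iSup_of_le (hp.mul ht) ?_
  refine Finset.sum_le_sum fun k _ => ?_
  unfold boxPhi
  gcongr with j
  exact secVar_comp_mul_le ht h _ _ j

end Scaling

theorem IsPhiFun.totalVar_sub_le {N : ℕ} {φ : ℝ → ℝ} (hφ : IsPhiFun φ)
    {g₁ g₂ : (Fin N → ℝ) → ℝ} (h₁ : Measurable g₁) (h₂ : Measurable g₂) :
    totalVar φ (fun s => g₁ s - g₂ s) ≤
      (2⁻¹ : ℝ≥0∞) * totalVar φ (fun s => 2 * g₁ s) +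
        (2⁻¹ : ℝ≥0∞) * totalVar φ (fun s => 2 * g₂ s) := by
  have hG : Measurable (Function.uncurry fun (i : Bool) (s : Fin N → ℝ) =>
      2 * bif i then g₁ s else g₂ s) :=
    measurable_from_prod_countable_right fun i => by
      cases i
      exacts [h₂.const_mul 2, h₁.const_mul 2]
  have hint : ∀ F : Bool → ℝ≥0∞, ∫⁻ i, F i ∂((2⁻¹ : ℝ≥0∞) • Measure.count) =
      2⁻¹ * F true + 2⁻¹ * F false := by
    intro F
    rw [lintegral_smul_measure, lintegral_count, tsum_fintype, Fintype.sum_bool, smul_eq_mul,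
      mul_add]
  have := hφ.totalVar_le_lintegral (g := fun s => g₁ s - g₂ s)
    (ν := (2⁻¹ : ℝ≥0∞) • Measure.count) hG fun p _ q _ => by
      rw [hint]
      simp only [cond_true, cond_false, ← mul_sub]
      convert! hφ.ofReal_abs_sub_le (g₁ p - g₁ q) (g₂ p - g₂ q) using 4
      ring
  rwa [hint] at this

/-- The measure `|k(t)| ⟨t⟩⁻¹ dt` on `ℝ^N_+`. -/
def mellinMeasure {N : ℕ} (k : (Fin N → ℝ) → ℝ) : Measure (Fin N → ℝ) :=
  (volume.restrict (RPos N)).withDensity fun t => ENNReal.ofReal (|k t| * (prodCoord t)⁻¹)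

section MellinMeasure

variable {N : ℕ} {k : (Fin N → ℝ) → ℝ}

theorem measurableSet_RPos : MeasurableSet (RPos N) := by
  rw [RPos, ofPred_forall]
  exact .iInter fun i => measurableSet_lt measurable_const (measurable_pi_apply i)

theorem prodCoord_pos {t : Fin N → ℝ} (ht : t ∈ RPos N) : 0 < prodCoord t :=
  Finset.prod_pos fun i _ => ht i

theorem measurable_prodCoord : Measurable (prodCoord : (Fin N → ℝ) → ℝ) := by
  unfold prodCoord
  fun_prop

theorem measurable_distOne : Measurable (distOne : (Fin N → ℝ) → ℝ) := by
  unfold distOne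
  fun_prop

theorem measurable_mellinDensity (hk : Measurable k) :
    Measurable fun t => ENNReal.ofReal (|k t| * (prodCoord t)⁻¹) :=
  ((measurable_abs.comp hk).mul measurable_prodCoord.inv).ennreal_ofReal

theorem ae_mellinMeasure_mem_RPos : ∀ᵐ t ∂mellinMeasure k, t ∈ RPos N :=
  (withDensity_absolutelyContinuous _ _).ae_le (ae_restrict_mem measurableSet_RPos)

theorem mellinMeasure_apply
    (hint : IntegrableOn (fun t => k t * (prodCoord t)⁻¹) (RPos N)) {S : Set (Fin N → ℝ)}
    (hS : MeasurableSet S) :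
    mellinMeasure k S =
      ENNReal.ofReal (∫ t in S ∩ RPos N, |k t| * (prodCoord t)⁻¹) := by
  have hint' : IntegrableOn (fun t => |k t| * (prodCoord t)⁻¹) (RPos N) := by
    refine (integrableOn_congr_fun (fun t ht => ?_) measurableSet_RPos).1 hint.norm
    rw [Real.norm_eq_abs, abs_mul, abs_of_pos (inv_pos.2 (prodCoord_pos ht))]
  rw [mellinMeasure, withDensity_apply _ hS, Measure.restrict_restrict hS,
    ofReal_integral_eq_lintegral_ofReal (hint'.mono_set inter_subset_right)]
  filter_upwards [ae_restrict_mem (hS.inter measurableSet_RPos)] with t ht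
  have := prodCoord_pos ht.2
  simp only [Pi.zero_apply]
  positivity

theorem exists_sign_integral_mellinMeasure_eq (hk : Measurable k)
    (hint : IntegrableOn (fun t => k t * (prodCoord t)⁻¹) (RPos N))
    (hone : ∫ t in RPos N, k t * (prodCoord t)⁻¹ = 1) (f : (Fin N → ℝ) → ℝ)
    (hdom : ∀ s ∈ RPos N,
      IntegrableOn (fun t => k t * f (s * t) * (prodCoord t)⁻¹) (RPos N)) :
    ∃ σ : (Fin N → ℝ) → ℝ, (∀ t, |σ t| = 1) ∧ ∀ s ∈ RPos N,
      Integrable (fun t => σ t * (f (s * t) - f s)) (mellinMeasure k) ∧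
        ∫ t, σ t * (f (s * t) - f s) ∂mellinMeasure k = mellinOp k f s - f s := by
  refine ⟨fun t => if 0 ≤ k t then 1 else -1, fun t => by dsimp only; split_ifs <;> simp,
    fun s hs => ?_⟩
  set σ : (Fin N → ℝ) → ℝ := fun t => if 0 ≤ k t then 1 else -1 with hσ
  have hσk : ∀ t, |k t| * σ t = k t := by
    intro t
    by_cases h : 0 ≤ k t
    · simp [hσ, h, abs_of_nonneg h]
    · simp [hσ, h, abs_of_neg (not_le.1 h)]
  have heq : EqOn (fun t => k t * f (s * t) * (prodCoord t)⁻¹ - f s * (k t * (prodCoord t)⁻¹))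
      (fun t => (ENNReal.ofReal (|k t| * (prodCoord t)⁻¹)).toReal • (σ t * (f (s * t) - f s)))
      (RPos N) := by
    intro t ht
    have := prodCoord_pos ht
    dsimp only
    rw [ENNReal.toReal_ofReal (by positivity), smul_eq_mul]
    nth_rewrite 1 2 [← hσk t]
    ring
  have hI := (hdom s hs).sub (hint.const_mul (f s))
  have hlt : ∀ᵐ t ∂(volume.restrict (RPos N)),
      ENNReal.ofReal (|k t| * (prodCoord t)⁻¹) < ∞ :=
    Eventually.of_forall fun _ => ENNReal.ofReal_lt_top
  constructor
  · rw [mellinMeasure, integrable_withDensity_iff_integrable_smul' (measurable_mellinDensity hk) hlt]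
    exact (integrableOn_congr_fun heq measurableSet_RPos).1 hI
  · rw [mellinMeasure,
      integral_withDensity_eq_integral_toReal_smul (measurable_mellinDensity hk) hlt,
      ← setIntegral_congr_fun measurableSet_RPos heq,
      integral_sub (hdom s hs) (hint.const_mul (f s)), integral_const_mul, hone, mul_one]
    rfl

end MellinMeasure

/-- for `f ∈ BV^φ(ℝ^N_+)` and kernels satisfying `(K_w.1)`, for every
`λ > 0`, `δ ∈ (0,1)` and `w > 0`,
`V^φ[λ(T_w f − f)] ≤ ω^φ(λAf, δ) + A⁻¹ V^φ[2λAf] ∫_{|1−t|>δ} |K_w(t)| ⟨t⟩⁻¹ dt`. -/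
theorem statement3 {N : ℕ} (hN : 1 ≤ N) (φ : ℝ → ℝ) (hφ : IsPhiFun φ)
    (K : ℝ → (Fin N → ℝ) → ℝ) (A : ℝ) (hA : 0 < A) (hK : KernelCond1 K A)
    (f : (Fin N → ℝ) → ℝ) (hf : MemBVphi φ f) (hdom : InDomain K f) :
    ∀ l > (0 : ℝ), ∀ δ : ℝ, 0 < δ → δ < 1 → ∀ w > (0 : ℝ),
      totalVar φ (fun s => l * (mellinOp (K w) f s - f s)) ≤
        modSmooth φ (fun x => l * A * f x) δ +
          ENNReal.ofReal A⁻¹ * totalVar φ (fun x => 2 * l * A * f x) *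
            ENNReal.ofReal
              (∫ t in {t ∈ RPos N | δ < distOne t}, |K w t| * (prodCoord t)⁻¹) := by
  intro l hl δ hδ hδ1 w hw
  obtain ⟨hk, hint, hmass, hone⟩ := hK w hw
  set V := totalVar φ (fun x => 2 * l * A * f x) with hV
  set W := modSmooth φ (fun x => l * A * f x) δ with hW
  set μ := mellinMeasure (K w) with hμ
  have hfm : Measurable f := hf.1
  have hμA : μ univ ≤ ENNReal.ofReal A := by
    rw [hμ, mellinMeasure_apply hint .univ, univ_inter]
    exact ENNReal.ofReal_le_ofReal hmass
  have : IsFiniteMeasure μ := ⟨hμA.trans_lt ENNReal.ofReal_lt_top⟩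
  obtain ⟨σ, hσ, hσI⟩ := exists_sign_integral_mellinMeasure_eq hk hint hone f (hdom w hw)
  have hmul : Measurable fun p : (Fin N → ℝ) × (Fin N → ℝ) => p.2 * p.1 :=
    measurable_snd.mul measurable_fst
  have hG : Measurable (Function.uncurry fun t s : Fin N → ℝ =>
      l * A * f (s * t) - l * A * f s) :=
    ((hfm.comp hmul).const_mul _).sub ((hfm.comp measurable_snd).const_mul _)
  have hmain := hφ.totalVar_le_lintegral (ν := ENNReal.ofReal A⁻¹ • μ)
    (g := fun s => l * (mellinOp (K w) f s - f s)) hG fun p hp q hq => by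
      obtain ⟨hpI, hpe⟩ := hσI p hp
      obtain ⟨hqI, hqe⟩ := hσI q hq
      have hJ := hφ.ofReal_abs_integral_le hA hμA ((hpI.sub hqI).const_mul l)
      rw [integral_const_mul] at hJ
      simp only [Pi.sub_apply] at hJ
      rw [integral_sub hpI hqI, hpe, hqe, mul_sub] at hJ
      rw [lintegral_smul_measure, smul_eq_mul]
      refine hJ.trans_eq ?_
      congr 1
      refine lintegral_congr fun t => ?_
      rw [show A * (l * (σ t * (f (p * t) - f p) - σ t * (f (q * t) - f q))) =
        σ t * (l * A * f (p * t) - l * A * f p - (l * A * f (q * t) - l * A * f q)) by ring,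
        abs_mul, hσ, one_mul]
  have hS : MeasurableSet {t : Fin N → ℝ | δ < distOne t} :=
    measurableSet_lt measurable_const measurable_distOne
  have hpt : ∀ᵐ t ∂μ, totalVar φ (fun s => l * A * f (s * t) - l * A * f s) ≤
      W + {t : Fin N → ℝ | δ < distOne t}.indicator (fun _ => V) t := by
    filter_upwards [ae_mellinMeasure_mem_RPos] with t ht
    by_cases hd : δ < distOne t
    · rw [indicator_of_mem (show t ∈ {t : Fin N → ℝ | δ < distOne t} from hd)]
      refine le_trans ?_ le_add_self
      refine (hφ.totalVar_sub_le (g₁ := fun s => l * A * f (s * t)) (g₂ := fun s => l * A * f s)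
        ((hfm.comp (measurable_id.mul_const t)).const_mul _) (hfm.const_mul _)).trans ?_
      have h2 : (fun s => 2 * (l * A * f s)) = fun s => 2 * l * A * f s := by
        funext s; ring
      have h1 : totalVar φ (fun s => 2 * (l * A * f (s * t))) ≤ V := by
        rw [hV, ← h2]
        exact totalVar_comp_mul_le φ ht fun s => 2 * (l * A * f s)
      rw [h2]
      calc _ ≤ (2⁻¹ : ℝ≥0∞) * V + (2⁻¹ : ℝ≥0∞) * V := by gcongr
        _ = V := by rw [← add_mul, ENNReal.inv_two_add_inv_two, one_mul]
    · refine le_trans ?_ le_self_add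
      exact le_iSup_of_le t <| le_iSup_of_le ht <| le_iSup_of_le (not_lt.1 hd) le_rfl
  calc totalVar φ (fun s => l * (mellinOp (K w) f s - f s))
      ≤ ENNReal.ofReal A⁻¹ * ∫⁻ t, totalVar φ (fun s => l * A * f (s * t) - l * A * f s) ∂μ := by
        rwa [lintegral_smul_measure, smul_eq_mul] at hmain
    _ ≤ ENNReal.ofReal A⁻¹ *
        ∫⁻ t, W + {t : Fin N → ℝ | δ < distOne t}.indicator (fun _ => V) t ∂μ := by
        gcongr ENNReal.ofReal A⁻¹ * ?_
        exact lintegral_mono_ae hpt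
    _ = ENNReal.ofReal A⁻¹ * (W * μ univ) +
        ENNReal.ofReal A⁻¹ * V * μ {t : Fin N → ℝ | δ < distOne t} := by
        rw [lintegral_add_left measurable_const, lintegral_const, lintegral_indicator_const hS,
          mul_add, mul_assoc]
    _ ≤ _ := by
        gcongr
        · calc ENNReal.ofReal A⁻¹ * (W * μ univ)
              ≤ ENNReal.ofReal A⁻¹ * (W * ENNReal.ofReal A) := by gcongr
            _ = W := by
              rw [mul_left_comm, ← ENNReal.ofReal_mul (by positivity), inv_mul_cancel₀ hA.ne',
                ENNReal.ofReal_one, mul_one]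
        · rw [hμ, mellinMeasure_apply hint hS, inter_comm]
          rfl

end
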